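/- Let S be a commutative ring and let A = S[ε] = S[X]/(X²) be the ring of dual numbers over S. Let M be an S-module that is free as an S-module, regarded as an A-module on which ε acts as zero (via the augmentation A → S, ε ↦ 0), and regard S itself as an A-module via the augmentation. Then for every natural number n there is an isomorphism of abelian groups Ext_A^n(M, S) ≅ Hom_S(M, S). -/

import Mathlib

open CategoryTheory

/-- The augmentation `S[ε] → S`, `ε ↦ 0`, as a ring homomorphism. -/
noncomputable def aug (S : Type) [CommRing S] : DualNumber S →+* S :=
  (TrivSqZeroExt.fstHom S S S).toRingHom

section Gen
open CategoryTheory Limits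

variable {C : Type*} [Category C] [Abelian C]

/-- The periodic complex `⋯ → P → P → P`. -/
noncomputable def perComplex (P : C) (d : P ⟶ P) (hd : d ≫ d = 0) : ChainComplex C ℕ :=
  ChainComplex.of (fun _ => P) (fun _ => d) (fun _ => hd)

theorem perComplex_d (P : C) (d : P ⟶ P) (hd : d ≫ d = 0) (n : ℕ) :
    (perComplex P d hd).d (n + 1) n = d :=
  ChainComplex.of_d (fun _ => P) (fun _ => d) n

/-- The associated projective resolution. -/
noncomputable def perRes {Z P : C} [Projective P] (d : P ⟶ P) (hd : d ≫ d = 0)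
    (he : (ShortComplex.mk d d hd).Exact) (p : P ⟶ Z) (hp : d ≫ p = 0)
    (hep : (ShortComplex.mk d p hp).Exact) [Epi p] : ProjectiveResolution Z where
  complex := perComplex P d hd
  projective _ := inferInstanceAs (Projective P)
  π := (ChainComplex.toSingle₀Equiv _ _).symm ⟨p, by
    rw [perComplex_d P d hd 0]; exact hp⟩
  quasiIso := ⟨fun n => by
    cases n with
    | zero =>
      rw [ChainComplex.quasiIsoAt₀_iff, ShortComplex.quasiIso_iff_of_zeros']
      · refine (ShortComplex.exact_and_epi_g_iff_of_iso ?_).2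
          ⟨hep, by assumption⟩
        refine ShortComplex.isoMk (Iso.refl _) (Iso.refl _) (Iso.refl _) ?_ ?_
        · refine (Category.id_comp _).trans ?_
          refine Eq.trans ?_ (Category.comp_id _).symm
          exact (perComplex_d P d hd 0).symm
        · refine (Category.id_comp _).trans ?_
          refine Eq.trans ?_ (Category.comp_id _).symm
          exact (ChainComplex.toSingle₀Equiv_symm_apply_f_zero (C := perComplex P d hd) p _).symm
      all_goals rfl
    | succ n =>
      rw [quasiIsoAt_iff_exactAt']
      · rw [HomologicalComplex.exactAt_iff' _ (n + 1 + 1) (n + 1) n (by simp) (by simp)]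
        refine (ShortComplex.exact_iff_of_iso ?_).2 he
        refine ShortComplex.isoMk (Iso.refl _) (Iso.refl _) (Iso.refl _) ?_ ?_
        · refine (Category.id_comp _).trans ?_
          refine Eq.trans ?_ (Category.comp_id _).symm
          exact (perComplex_d P d hd (n+1)).symm
        · refine (Category.id_comp _).trans ?_
          refine Eq.trans ?_ (Category.comp_id _).symm
          exact (perComplex_d P d hd n).symm
      · apply ChainComplex.exactAt_succ_single_obj⟩

theorem ext_per {R : Type*} [Ring R] [Linear R C] [EnoughProjectives C]
    {Z P : C} [Projective P] (d : P ⟶ P) (hd : d ≫ d = 0)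
    (he : (ShortComplex.mk d d hd).Exact) (p : P ⟶ Z) (hp : d ≫ p = 0)
    (hep : (ShortComplex.mk d p hp).Exact) [Epi p] (Y : C)
    (hY : ∀ f : P ⟶ Y, d ≫ f = 0) (n : ℕ) :
    Nonempty ((((Ext R C n).obj (Opposite.op Z)).obj Y) ≃+ (P ⟶ Y)) := by
  let e := (perRes d hd he p hp hep).isoExt (R := R) n Y
  let K := ((perRes d hd he p hp hep).complex.linearYonedaObj R Y)
  have hK : ∀ i j, K.d i j = 0 := by
    intro i j
    by_cases h : i + 1 = j
    · subst h
      ext (f : P ⟶ Y)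
      refine Eq.trans ?_ (hY f)
      exact congrArg (· ≫ f) (perComplex_d P d hd i)
    · exact K.shape _ _ h
  let e2 := (ShortComplex.HomologyData.ofZeros (K.sc n) (hK _ _) (hK _ _)).left.homologyIso
  exact ⟨(e ≪≫ e2).toLinearEquiv.toAddEquiv⟩

end Gen

theorem ext_dual_key (S M N : Type) [CommRing S] [AddCommGroup M] [Module S M]
    [Module.Free S M] [Module (DualNumber S) M] [AddCommGroup N] [Module S N]
    [Module (DualNumber S) N]
    (hM : ∀ (a : DualNumber S) (m : M), a • m = a.fst • m)
    (hN : ∀ (a : DualNumber S) (m : N), a • m = a.fst • m) (n : ℕ) :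
    Nonempty
      ((((Ext (DualNumber S) (ModuleCat (DualNumber S)) n).obj
          (Opposite.op (ModuleCat.of (DualNumber S) M))).obj
          (ModuleCat.of (DualNumber S) N)) ≃+ (M →ₗ[S] N)) := by
  obtain ⟨ι, b⟩ : Σ ι : Type, Module.Basis ι S M := ⟨_, Module.Free.chooseBasis S M⟩
  let dl : (ι →₀ DualNumber S) →ₗ[DualNumber S] (ι →₀ DualNumber S) := LinearMap.lsmul (DualNumber S) (ι →₀ DualNumber S) DualNumber.eps
  let pl : (ι →₀ DualNumber S) →ₗ[DualNumber S] M := Finsupp.linearCombination (DualNumber S) b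
  have hdl : ∀ (x : (ι →₀ DualNumber S)) i, dl x i = DualNumber.eps * x i := fun x i => rfl
  have hlift : ∀ x : (ι →₀ DualNumber S), (∀ i, (x i).fst = 0) → ∃ y, dl y = x := by
    intro x hx
    refine ⟨x.mapRange (fun a => TrivSqZeroExt.inl a.snd) (by rfl), ?_⟩
    ext i
    · rw [hdl]; simp [hx i]
    · rw [hdl]; simp; rfl
  have hpl : ∀ (x : (ι →₀ DualNumber S)) i, b.repr (pl x) i = (x i).fst := by
    intro x i
    induction x using Finsupp.induction_linear with
    | zero => simp
    | add f g hf hg => rw [map_add, map_add, Finsupp.add_apply, hf, hg]; simp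
    | single j a =>
      simp only [pl, Finsupp.linearCombination_single, hM, map_smul, Module.Basis.repr_self]
      classical
      by_cases h : j = i
      · subst h; simp
      · simp [Finsupp.single_apply, h]
  have hsurj : Function.Surjective pl := by
    intro m
    refine ⟨(b.repr m).mapRange (fun a => TrivSqZeroExt.inl a) (by rfl), ?_⟩
    apply b.repr.injective
    ext i
    rw [hpl]; rfl
  have hd0 : ∀ x, dl (dl x) = 0 := by
    intro x
    ext i <;> rw [hdl, hdl] <;> simp
  have hp0 : ∀ x, pl (dl x) = 0 := by
    intro x
    apply b.repr.injective
    ext i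
    rw [hpl, hdl]; simp
  let P : ModuleCat (DualNumber S) := ModuleCat.of (DualNumber S) (ι →₀ DualNumber S)
  let d : P ⟶ P := ModuleCat.ofHom dl
  let p : P ⟶ ModuleCat.of (DualNumber S) M := ModuleCat.ofHom pl
  have : Projective P := (IsProjective.iff_projective (ι →₀ DualNumber S)).1 inferInstance
  have hd : d ≫ d = 0 := ModuleCat.hom_ext (LinearMap.ext hd0)
  have hp : d ≫ p = 0 := ModuleCat.hom_ext (LinearMap.ext hp0)
  have : Epi p := (ModuleCat.epi_iff_surjective p).2 hsurj
  have he : (ShortComplex.mk d d hd).Exact := by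
    rw [ShortComplex.moduleCat_exact_iff]
    intro (x : (ι →₀ DualNumber S)) (hx : dl x = 0)
    refine hlift x fun i => ?_
    have := congrArg TrivSqZeroExt.snd (DFunLike.congr_fun hx i)
    rw [hdl] at this
    simpa using this
  have hep : (ShortComplex.mk d p hp).Exact := by
    rw [ShortComplex.moduleCat_exact_iff]
    intro (x : (ι →₀ DualNumber S)) (hx : pl x = 0)
    refine hlift x fun i => ?_
    rw [← hpl, hx]; simp
  have hY : ∀ f : P ⟶ ModuleCat.of (DualNumber S) N, d ≫ f = 0 := by
    intro f
    refine ModuleCat.hom_ext (LinearMap.ext fun (x : ι →₀ DualNumber S) => ?_)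
    change f.hom ((DualNumber.eps : DualNumber S) • x) = 0
    rw [map_smul]
    refine (hN _ _).trans ?_
    simp
  obtain ⟨e⟩ := ext_per (R := DualNumber S) d hd he p hp hep (ModuleCat.of (DualNumber S) N) hY n
  let e1 : (P ⟶ ModuleCat.of (DualNumber S) N) ≃+ ((ι →₀ DualNumber S) →ₗ[DualNumber S] N) :=
    ModuleCat.homAddEquiv
  let e2 : (ι → N) ≃+ ((ι →₀ DualNumber S) →ₗ[DualNumber S] N) := (Finsupp.lift N (DualNumber S) ι)
  let e3 : (ι → N) ≃+ (M →ₗ[S] N) := (b.constr ℕ).toAddEquiv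
  exact ⟨e.trans (e1.trans (e2.symm.trans e3))⟩

/-- Let `A = S[ε]` be the dual numbers over a commutative ring `S`,
let `M` be a free `S`-module regarded as an `A`-module on which `ε` acts as zero
(via the augmentation), and regard `S` as an `A`-module via the augmentation.  Then
for every `n` there is an isomorphism of abelian groups
`Ext_A^n(M, S) ≅ Hom_S(M, S)`. -/
theorem ext_dualNumber_iso_hom (S : Type) [CommRing S] (M : Type) [AddCommGroup M]
    [Module S M] (hfree : Module.Free S M) (n : ℕ) :
    letI : Module (DualNumber S) M := Module.compHom M (aug S)
    letI : Module (DualNumber S) S := Module.compHom S (aug S)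
    Nonempty
      ((((Ext (DualNumber S) (ModuleCat (DualNumber S)) n).obj
          (Opposite.op (ModuleCat.of (DualNumber S) M))).obj
          (ModuleCat.of (DualNumber S) S)) ≃+ (M →ₗ[S] S)) := by
  letI : Module (DualNumber S) M := Module.compHom M (aug S)
  letI : Module (DualNumber S) S := Module.compHom S (aug S)
  exact ext_dual_key S M S (fun _ _ => rfl) (fun _ _ => rfl) n
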